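/- arXiv:1507.05779 — 4 statements merged into one kernel-verified Lean document; each statement's English description precedes it below -/
import Mathlib

section
/- Let $k \geq 1$ be an integer, $G = (\mathbb{Z}/2\mathbb{Z})^k$, and let $T_1$ be the tuple of length $r_1 = k(k+1)$ in which the standard basis vector $e_i$ occurs exactly $2i$ times. Suppose $T_2'$ and $T_2''$ are two tuples of elements of $G$ of the same length $r_2$, and suppose there exist permutations $\sigma \in \mathfrak{S}_{r_1}$, $\tau \in \mathfrak{S}_{r_2}$ and an automorphism $\phi$ of $G$ such that applying $\phi$ entrywise to the $\sigma$-permuted tuple $T_1$ gives back $T_1$, and applying $\phi$ entrywise to the $\tau$-permuted tuple $T_2'$ gives $T_2''$. Then $T_2'$ and $T_2''$ determine the same multiset of entries. -/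
/-- If `g ∘ f ∘ σ = f'` for a permutation `σ`, then `g` maps the multiset of entries of `f` to the
multiset of entries of `f'`. -/
theorem Multiset.map_coe_ofFn_of_perm {α β : Type*} {n : ℕ} {f : Fin n → α} {f' : Fin n → β}
    {g : α → β} (σ : Equiv.Perm (Fin n)) (h : ∀ x, g (f (σ x)) = f' x) :
    (↑(List.ofFn f) : Multiset α).map g = ↑(List.ofFn f') := by
  obtain rfl : f' = (g ∘ f) ∘ σ := funext fun x => (h x).symm
  rw [Multiset.map_coe, List.map_ofFn, Multiset.coe_eq_coe]
  exact (Equiv.Perm.ofFn_comp_perm σ (g ∘ f)).symm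

/-- The multiplicity of a standard basis vector in a sum of replicated standard basis vectors. -/
theorem Multiset.count_single_sum_replicate {ι R : Type*} [Fintype ι] [DecidableEq ι]
    [DecidableEq R] [Zero R] [One R] [NeZero (1 : R)] (m : ι → ℕ) (i : ι) :
    (∑ j, Multiset.replicate (m j) (Pi.single j 1 : ι → R)).count (Pi.single i 1) = m i := by
  have h (j : ι) : (Pi.single j 1 : ι → R) = Pi.single i 1 ↔ j = i := by
    refine ⟨fun h => ?_, fun h => h ▸ rfl⟩
    by_contra hne
    simpa [Pi.single_apply, hne] using congrFun h j
  simp [Multiset.count_sum', Multiset.count_replicate, h]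

/-- An additive endomorphism of `(ℤ/2ℤ)^ι` fixing the standard basis is the identity. -/
theorem AddMonoidHom.eq_id_of_single_one {ι : Type*} [Finite ι] [DecidableEq ι]
    {f : (ι → ZMod 2) →+ (ι → ZMod 2)} (h : ∀ i, f (Pi.single i 1) = Pi.single i 1) :
    f = AddMonoidHom.id _ := by
  refine AddMonoidHom.functions_ext _ _ _ fun i x => ?_
  obtain rfl | rfl : x = 0 ∨ x = 1 := by revert x; decide
  · simp
  · exact h i

/-- For `k ≥ 1`, `G = (ℤ/2ℤ)^k`, and `T₁` the tuple of length
`r₁ = k(k+1)` in which `eᵢ` occurs exactly `2i` times: if `T₂'` and `T₂''` are tuples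
of elements of `G` of the same length `r₂` and there are permutations
`σ ∈ 𝔖_{r₁}`, `τ ∈ 𝔖_{r₂}` and an automorphism `φ` of `G` with `φ ∘ T₁ ∘ σ = T₁` and
`φ ∘ T₂' ∘ τ = T₂''`, then `T₂'` and `T₂''` determine the same multiset of entries. -/
theorem stmt8 (k : ℕ) (hk : 1 ≤ k) (r2 : ℕ)
    (T1 : Fin (k * (k + 1)) → (Fin k → ZMod 2))
    (hT1 : (↑(List.ofFn T1) : Multiset (Fin k → ZMod 2)) =
      Finset.univ.sum fun i : Fin k =>
        Multiset.replicate (2 * ((i : ℕ) + 1)) (Pi.single i 1))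
    (T2' T2'' : Fin r2 → (Fin k → ZMod 2))
    (σ : Equiv.Perm (Fin (k * (k + 1)))) (τ : Equiv.Perm (Fin r2))
    (φ : (Fin k → ZMod 2) ≃+ (Fin k → ZMod 2))
    (h1 : ∀ x, φ (T1 (σ x)) = T1 x)
    (h2 : ∀ x, φ (T2' (τ x)) = T2'' x) :
    (↑(List.ofFn T2') : Multiset (Fin k → ZMod 2)) = ↑(List.ofFn T2'') := by
  have hmap := Multiset.map_coe_ofFn_of_perm σ h1
  rw [hT1] at hmap
  have hfix (i : Fin k) : φ (Pi.single i 1) = Pi.single i 1 := by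
    have hcount := Multiset.count_map_eq_count' φ
      (∑ j : Fin k, Multiset.replicate (2 * ((j : ℕ) + 1)) (Pi.single j 1)) φ.injective
      (Pi.single i 1)
    rw [hmap, Multiset.count_single_sum_replicate fun j : Fin k => 2 * ((j : ℕ) + 1)] at hcount
    obtain ⟨j, -, hj⟩ := Multiset.mem_sum.1
      (Multiset.count_pos.1 (by rw [hcount]; positivity))
    have hj := Multiset.eq_of_mem_replicate hj
    rw [hj, Multiset.count_single_sum_replicate fun j : Fin k => 2 * ((j : ℕ) + 1)] at hcount
    rw [hj, show j = i from Fin.ext (by lia)]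
  have hid : φ.toAddMonoidHom = AddMonoidHom.id _ := AddMonoidHom.eq_id_of_single_one hfix
  have hφ (x : Fin k → ZMod 2) : φ x = x := DFunLike.congr_fun hid x
  rw [← Multiset.map_coe_ofFn_of_perm τ h2, Multiset.map_congr rfl fun x _ => hφ x, Multiset.map_id']
end

section
/- Let $k \geq 3$ be an integer, let $G = (\mathbb{Z}/2\mathbb{Z})^k$, $M := G \setminus \{0, e_1, \dots, e_k\}$, and let $N \geq 2^k - k - 1$ be an integer. The map sending a function $n : M \to \mathbb{N}_{\geq 1}$ with $\sum_{m \in M} n(m) = N$ to the multiset in which each $m \in M$ has multiplicity $2n(m)$ is injective; moreover, distinct such functions $n \neq n'$ yield pairs $(T_1, T_2(n))$ and $(T_1, T_2(n'))$ lying in distinct orbits of the action of $\mathfrak{S}_{r_1} \times \mathfrak{S}_{r_2} \times \mathrm{Aut}(G)$, where $T_2(n)$ is any tuple realizing the multiset associated to $n$ and $T_1$ is the tuple with $e_i$ occurring exactly $2i$ times. -/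
theorem Multiset.count_sum_replicate {ι α : Type*} [DecidableEq ι] [DecidableEq α]
    (s : Finset ι) (c : ι → ℕ) {g : ι → α} (hg : Function.Injective g) (a : ι) :
    Multiset.count (g a) (∑ i ∈ s, Multiset.replicate (c i) (g i)) =
      if a ∈ s then c a else 0 := by
  simp [Multiset.count_sum', Multiset.count_replicate, hg.eq_iff]

theorem List.coe_ofFn_eq_map_of_perm {α β : Type*} {r : ℕ} {T : Fin r → α} {T' : Fin r → β}
    {φ : α → β} (σ : Equiv.Perm (Fin r)) (h : ∀ x, φ (T (σ x)) = T' x) :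
    (List.ofFn T' : Multiset β) = (List.ofFn T : Multiset α).map φ := by
  rw [← Fin.univ_val_map, ← Fin.univ_val_map, Multiset.map_map, ← funext h]
  conv_rhs => rw [← Multiset.map_univ_val_equiv σ, Multiset.map_map]
  rfl

/-- An automorphism preserving a multiset of standard basis vectors with pairwise distinct
positive multiplicities is trivial. -/
theorem AddEquiv.eq_refl_of_map_sum_replicate_single {ι : Type*} [Fintype ι] [DecidableEq ι]
    {p : ℕ} [Fact (1 < p)] {c : ι → ℕ} (hc : Function.Injective c) (hpos : ∀ i, 0 < c i)
    (φ : (ι → ZMod p) ≃+ (ι → ZMod p))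
    (h : (∑ i, Multiset.replicate (c i) (Pi.single i (1 : ZMod p) : ι → ZMod p)).map φ =
      ∑ i, Multiset.replicate (c i) (Pi.single i 1)) :
    φ = AddEquiv.refl _ := by
  have hinj : Function.Injective fun i : ι => (Pi.single i (1 : ZMod p) : ι → ZMod p) :=
    fun i j hij => by
      by_contra hne
      simpa [hne] using congrFun hij i
  have hfix : ∀ i, φ (Pi.single i 1) = Pi.single i 1 := by
    intro i
    have hcount : Multiset.count (φ (Pi.single i 1))
        (∑ j, Multiset.replicate (c j) (Pi.single j (1 : ZMod p) : ι → ZMod p)) = c i := by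
      rw [← h, Multiset.count_map_eq_count' _ _ φ.injective,
        Multiset.count_sum_replicate _ _ hinj i]
      simp
    have hmem := Multiset.count_pos.1 (hcount ▸ hpos i)
    obtain ⟨j, -, hj⟩ := Multiset.mem_sum.1 hmem
    have hj := Multiset.eq_of_mem_replicate hj
    rw [hj, Multiset.count_sum_replicate _ _ hinj j, if_pos (Finset.mem_univ j)] at hcount
    rw [hj, hc hcount]
  have hhom : φ.toAddMonoidHom = AddMonoidHom.id _ := by
    ext i : 1
    apply AddMonoidHom.toZModLinearMap_injective p
    ext : 1
    simpa using hfix i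
  exact AddEquiv.ext fun v => DFunLike.congr_fun hhom v


/-- For `k ≥ 3`, `G = (ℤ/2ℤ)^k`, `M := G \ {0, e₁, …, e_k}` and
`N ≥ 2^k - k - 1`: the map sending a function `n : M → ℕ_{≥1}` with `∑_{m ∈ M} n(m) = N`
to the multiset in which each `m ∈ M` has multiplicity `2 n(m)` is injective; moreover
distinct such functions `n ≠ n'` yield pairs `(T₁, T₂(n))`, `(T₁, T₂(n'))` lying in
distinct orbits of the action of `𝔖_{r₁} × 𝔖_{r₂} × Aut(G)` (with `r₁ = k(k+1)`,
`r₂ = 2N`), where `T₂(n)` is any tuple realizing the multiset associated to `n` and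
`T₁` is the tuple with `eᵢ` occurring exactly `2i` times. -/
theorem stmt9 (k N : ℕ) (hk : 3 ≤ k) (hN : 2 ^ k - k - 1 ≤ N)
    (M : Finset (Fin k → ZMod 2))
    (hM : M = Finset.univ.filter fun v => v ≠ 0 ∧ ∀ i : Fin k, v ≠ Pi.single i 1)
    (n n' : (Fin k → ZMod 2) → ℕ)
    (hn1 : ∀ m ∈ M, 1 ≤ n m) (hn2 : ∑ m ∈ M, n m = N)
    (hn1' : ∀ m ∈ M, 1 ≤ n' m) (hn2' : ∑ m ∈ M, n' m = N)
    (mult : ((Fin k → ZMod 2) → ℕ) → Multiset (Fin k → ZMod 2))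
    (hmult : ∀ f, mult f = M.sum fun m => Multiset.replicate (2 * f m) m) :
    (mult n = mult n' → ∀ m ∈ M, n m = n' m) ∧
    ((∃ m ∈ M, n m ≠ n' m) →
      ∀ (T1 : Fin (k * (k + 1)) → (Fin k → ZMod 2))
        (T2 T2' : Fin (2 * N) → (Fin k → ZMod 2)),
        (↑(List.ofFn T1) : Multiset (Fin k → ZMod 2)) =
          (Finset.univ.sum fun i : Fin k =>
            Multiset.replicate (2 * ((i : ℕ) + 1)) (Pi.single i 1)) →
        (↑(List.ofFn T2) : Multiset (Fin k → ZMod 2)) = mult n →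
        (↑(List.ofFn T2') : Multiset (Fin k → ZMod 2)) = mult n' →
        ¬ ∃ (σ : Equiv.Perm (Fin (k * (k + 1)))) (τ : Equiv.Perm (Fin (2 * N)))
            (φ : (Fin k → ZMod 2) ≃+ (Fin k → ZMod 2)),
            (∀ x, φ (T1 (σ x)) = T1 x) ∧ (∀ x, φ (T2 (τ x)) = T2' x)) := by
  have hinj : mult n = mult n' → ∀ m ∈ M, n m = n' m := by
    intro h m hm
    have hcount := congrArg (Multiset.count m) h
    rw [hmult, hmult] at hcount
    have key := fun f : (Fin k → ZMod 2) → ℕ =>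
      Multiset.count_sum_replicate M (fun m => 2 * f m) Function.injective_id m
    simp only [id, if_pos hm] at key
    rw [key, key] at hcount
    omega
  refine ⟨hinj, ?_⟩
  rintro ⟨m, hm, hne⟩ T1 T2 T2' hT1 hT2 hT2' ⟨σ, τ, φ, hσ, hτ⟩
  have : Fact (1 < 2) := ⟨one_lt_two⟩
  have h1 := List.coe_ofFn_eq_map_of_perm σ hσ
  rw [hT1] at h1
  have hφ := AddEquiv.eq_refl_of_map_sum_replicate_single
    (fun i j hij => Fin.ext (by grind)) (fun i => by positivity) φ h1.symm
  subst hφ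
  have h2 := List.coe_ofFn_eq_map_of_perm τ hτ
  rw [hT2, hT2'] at h2
  exact hne (hinj (by simpa using h2.symm) m hm)
end

section
/- Let $k \geq 3$ and $l$ be integers with $2^{l-k} + 2 \geq 2^k - k - 1$, and set $G = (\mathbb{Z}/2\mathbb{Z})^k$, $r_1 = k(k+1)$, $r_2 = 2^{l-k+1} + 4$. Consider the set of pairs $(T_1, T_2)$ where $T_1$ is an $r_1$-tuple and $T_2$ an $r_2$-tuple of elements of $G$, each being a spherical system of generators of $G$ (all entries nonzero, entries generate $G$, sum of entries equals $0$), and such that no nonzero element of $G$ occurs both as an entry of $T_1$ and as an entry of $T_2$. Then the number of orbits of this set under the action of $\mathfrak{S}_{r_1} \times \mathfrak{S}_{r_2} \times \mathrm{Aut}(G)$ (permuting the entries of each tuple and applying the automorphism simultaneously to all entries) is at least $\binom{2^{l-k}+1}{2^k-k-2}$. -/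
/-- The nonzero vectors of `(ℤ/2ℤ)^k` that are not standard basis vectors. -/
abbrev NonBasis (k : ℕ) : Type :=
  {v : Fin k → ZMod 2 // v ≠ 0 ∧ ∀ i, v ≠ Pi.single i 1}

/-- The multiset containing the `i`-th standard basis vector `2 (i + 1)` times. -/
def basisMultiset (k : ℕ) : Multiset (Fin k → ZMod 2) :=
  ∑ i : Fin k, (2 * ((i : ℕ) + 1)) • {Pi.single i 1}

open Classical in
/-- The multiset containing every non-basis vector `v` with multiplicity `2 (1 + count v s)`. -/
noncomputable def nonBasisMultiset {k n : ℕ} (s : Sym (NonBasis k) n) :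
    Multiset (Fin k → ZMod 2) :=
  2 • ((Finset.univ.val + (s : Multiset (NonBasis k))).map Subtype.val)

/-- Every multiset of cardinality `n` is the multiset of entries of an `n`-tuple. -/
theorem exists_tuple_of_card {α : Type*} (m : Multiset α) (n : ℕ) (h : m.card = n) :
    ∃ f : Fin n → α, Finset.univ.val.map f = m := by
  subst h
  induction m using Quotient.inductionOn with
  | h L => exact ⟨L.get, (Fin.univ_val_map L.get).trans (congrArg _ (List.ofFn_get L))⟩

theorem single_one_injective (k : ℕ) :
    Function.Injective (fun i : Fin k => (Pi.single i 1 : Fin k → ZMod 2)) := by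
  intro i j h
  by_contra hij
  have := congrFun h i
  simp [hij] at this

theorem closure_range_single_one (k : ℕ) :
    AddSubgroup.closure (Set.range fun i : Fin k => (Pi.single i 1 : Fin k → ZMod 2)) = ⊤ := by
  rw [eq_top_iff]
  intro v _
  rw [← Finset.univ_sum_single v]
  refine sum_mem fun i _ => ?_
  have h01 : v i = 0 ∨ v i = 1 := by
    generalize v i = a
    revert a
    decide
  rcases h01 with h | h
  · rw [h, Pi.single_zero]
    exact zero_mem _
  · rw [h]
    exact AddSubgroup.subset_closure ⟨i, rfl⟩

theorem count_single_basisMultiset {k : ℕ} (i : Fin k) :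
    (basisMultiset k).count (Pi.single i 1) = 2 * ((i : ℕ) + 1) := by
  classical
  have h : ∀ j : Fin k, ((Pi.single i 1 : Fin k → ZMod 2) = Pi.single j 1) ↔ i = j :=
    fun j => (single_one_injective k).eq_iff
  simp [basisMultiset, Multiset.count_sum', Multiset.count_nsmul, Multiset.count_singleton, h]

theorem mem_basisMultiset {k : ℕ} {v : Fin k → ZMod 2} :
    v ∈ basisMultiset k ↔ ∃ i, v = Pi.single i 1 := by
  simp [basisMultiset, Multiset.mem_sum, Multiset.mem_nsmul]

theorem card_basisMultiset (k : ℕ) : (basisMultiset k).card = k * (k + 1) := by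
  simp only [basisMultiset, Multiset.card_sum, Multiset.card_nsmul, Multiset.card_singleton,
    mul_one]
  rw [Fin.sum_univ_eq_sum_range (fun i => 2 * (i + 1)) k]
  induction k with
  | zero => rfl
  | succ n ih => rw [Finset.sum_range_succ, ih]; ring

theorem two_nsmul_zmod_two {k : ℕ} (v : Fin k → ZMod 2) : 2 • v = 0 := by
  ext i
  simp [CharTwo.two_eq_zero]

theorem sum_basisMultiset (k : ℕ) : (basisMultiset k).sum = 0 := by
  simp [basisMultiset, Multiset.sum_sum, Multiset.sum_nsmul, mul_nsmul, two_nsmul_zmod_two,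
    -nsmul_eq_mul]

theorem mem_nonBasisMultiset {k n : ℕ} (s : Sym (NonBasis k) n) {v : Fin k → ZMod 2} :
    v ∈ nonBasisMultiset s ↔ v ≠ 0 ∧ ∀ i, v ≠ Pi.single i 1 := by
  classical
  rw [nonBasisMultiset, Multiset.mem_nsmul]
  constructor
  · rintro ⟨-, h⟩
    obtain ⟨w, -, rfl⟩ := Multiset.mem_map.1 h
    exact w.2
  · intro h
    exact ⟨two_ne_zero, Multiset.mem_map.2
      ⟨⟨v, h⟩, Multiset.mem_add.2 (Or.inl (Finset.mem_univ _)), rfl⟩⟩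

theorem sum_nonBasisMultiset {k n : ℕ} (s : Sym (NonBasis k) n) :
    (nonBasisMultiset s).sum = 0 := by
  rw [nonBasisMultiset, Multiset.sum_nsmul, two_nsmul_zmod_two]

theorem card_nonBasis (k : ℕ) : Nat.card (NonBasis k) = 2 ^ k - k - 1 := by
  classical
  have hset : {v : Fin k → ZMod 2 | v ≠ 0 ∧ ∀ i, v ≠ Pi.single i 1} =
      ((insert 0 (Finset.univ.image fun i : Fin k => (Pi.single i 1 : Fin k → ZMod 2)) :
        Finset (Fin k → ZMod 2))ᶜ : Finset (Fin k → ZMod 2)) := by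
    ext v
    simp [eq_comm, and_comm]
  change Nat.card {v : Fin k → ZMod 2 | v ≠ 0 ∧ ∀ i, v ≠ Pi.single i 1} = _
  rw [hset, Nat.card_coe_set_eq, Set.ncard_coe_finset, Finset.card_compl,
    Finset.card_insert_of_notMem (by simp), Finset.card_image_of_injective _
      (single_one_injective k)]
  simp [Nat.sub_sub]

theorem card_nonBasisMultiset {k n : ℕ} (s : Sym (NonBasis k) n) :
    (nonBasisMultiset s).card = 2 * (2 ^ k - k - 1 + n) := by
  classical
  simp only [nonBasisMultiset, Multiset.card_nsmul, Multiset.card_map, Multiset.card_add,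
    Finset.card_val, Finset.card_univ, ← Nat.card_eq_fintype_card, card_nonBasis, Sym.card_coe]

theorem nonBasisMultiset_injective (k n : ℕ) :
    Function.Injective (nonBasisMultiset : Sym (NonBasis k) n → _) := by
  classical
  intro s t h
  apply Sym.coe_injective
  have h2 := nsmul_right_injective two_ne_zero h
  exact add_left_cancel (Multiset.map_injective Subtype.val_injective h2)

/-- In rank at least `3` the non-basis vectors generate, as
`e i = (e i + e a + e b) + (e a + e b)` for distinct `i`, `a`, `b`. -/
theorem closure_nonBasis {k : ℕ} (hk : 3 ≤ k) :
    AddSubgroup.closure {v : Fin k → ZMod 2 | v ≠ 0 ∧ ∀ i, v ≠ Pi.single i 1} = ⊤ := by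
  rw [eq_top_iff, ← closure_range_single_one, AddSubgroup.closure_le]
  rintro _ ⟨i, rfl⟩
  obtain ⟨a, ha⟩ : ∃ a, a ∉ ({i} : Finset (Fin k)) :=
    Finset.exists_mem_notMem_of_card_lt_card (s := {i}) (t := Finset.univ)
      (by simp; omega) |>.imp fun _ h => h.2
  obtain ⟨b, hb⟩ : ∃ b, b ∉ ({i, a} : Finset (Fin k)) :=
    Finset.exists_mem_notMem_of_card_lt_card (s := {i, a}) (t := Finset.univ)
      (lt_of_le_of_lt Finset.card_le_two (by simp; omega)) |>.imp fun _ h => h.2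
  simp only [Finset.mem_insert, Finset.mem_singleton, not_or] at ha hb
  obtain ⟨hbi, hba⟩ := hb
  have hmem : ∀ v : Fin k → ZMod 2, v a = 1 → v b = 1 →
      v ∈ AddSubgroup.closure {v : Fin k → ZMod 2 | v ≠ 0 ∧ ∀ i, v ≠ Pi.single i 1} := by
    intro v hva hvb
    refine AddSubgroup.subset_closure ⟨?_, ?_⟩
    · rintro rfl
      simp at hva
    · rintro j rfl
      rw [Pi.single_apply] at hva hvb
      have h1 : a = j := by by_contra h; simp [h] at hva
      have h2 : b = j := by by_contra h; simp [h] at hvb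
      exact hba (h2.trans h1.symm)
  have hsub := sub_mem (hmem (Pi.single i 1 + (Pi.single a 1 + Pi.single b 1))
      (by simp [ha, Ne.symm hba]) (by simp [hbi, hba]))
    (hmem (Pi.single a 1 + Pi.single b 1)
      (by simp [Ne.symm hba]) (by simp [hba]))
  rwa [add_sub_cancel_right] at hsub

/-- The multiplicities in `basisMultiset` are distinct, so only the identity preserves it. -/
theorem eq_refl_of_map_basisMultiset {k : ℕ} (φ : (Fin k → ZMod 2) ≃+ (Fin k → ZMod 2))
    (h : (basisMultiset k).map φ = basisMultiset k) : φ = AddEquiv.refl _ := by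
  classical
  have hfix : ∀ i, φ (Pi.single i 1) = Pi.single i 1 := by
    intro i
    have hc : (basisMultiset k).count (φ (Pi.single i 1)) = 2 * ((i : ℕ) + 1) := by
      conv_lhs => rw [← h]
      rw [Multiset.count_map_eq_count' _ _ φ.injective, count_single_basisMultiset]
    obtain ⟨j, hj⟩ := mem_basisMultiset.1
      (Multiset.count_pos.1 (by omega : 0 < (basisMultiset k).count (φ (Pi.single i 1))))
    rw [hj, count_single_basisMultiset] at hc
    rw [hj, Fin.ext (by omega : (j : ℕ) = i)]
  have hhom : φ.toAddMonoidHom = AddMonoidHom.id _ := by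
    refine AddMonoidHom.eq_of_eqOn_dense (closure_range_single_one k) ?_
    rintro _ ⟨i, rfl⟩
    exact hfix i
  ext1 v
  exact DFunLike.congr_fun hhom v

/-- Permuting the entries of a tuple does not change its multiset of entries. -/
theorem map_entries_eq {α β ι : Type*} [Fintype ι] {f : ι → α} {g : ι → β} (φ : α → β)
    (σ : Equiv.Perm ι) (h : ∀ x, φ (f (σ x)) = g x) :
    (Finset.univ.val.map f).map φ = Finset.univ.val.map g := by
  rw [Multiset.map_map]
  conv_lhs => rw [← Multiset.map_univ_val_equiv σ, Multiset.map_map]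
  exact Multiset.map_congr rfl fun x _ => h x

theorem choose_eq_card_sym {k M : ℕ} (hk : 3 ≤ k) (hM : 2 ^ k - k - 1 ≤ M + 1) :
    Nat.choose M (2 ^ k - k - 2) = Nat.card (Sym (NonBasis k) (M + 1 - (2 ^ k - k - 1))) := by
  classical
  have hpow : k + 2 ≤ 2 ^ k := by
    induction k, hk using Nat.le_induction with
    | base => norm_num
    | succ n hn ih =>
      have := Nat.lt_two_pow_self (n := n)
      rw [pow_succ]
      omega
  rw [Nat.card_eq_fintype_card, Sym.card_sym_eq_choose, ← Nat.card_eq_fintype_card,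
    card_nonBasis, show 2 ^ k - k - 1 + (M + 1 - (2 ^ k - k - 1)) - 1 = M by omega]
  exact Nat.choose_symm_of_eq_add (by omega)

/-- Tuples in the same orbit have multisets of entries related by a single automorphism. -/
theorem exists_addEquiv_of_eqvGen {V ι κ : Type*} [AddCommGroup V] [Fintype ι] [Fintype κ]
    {p : (ι → V) × (κ → V) → Prop} {r : Subtype p → Subtype p → Prop}
    (hr : ∀ P P', r P P' → ∃ (σ : Equiv.Perm ι) (τ : Equiv.Perm κ) (φ : V ≃+ V),
      (∀ x, φ (P.1.1 (σ x)) = P'.1.1 x) ∧ (∀ x, φ (P.1.2 (τ x)) = P'.1.2 x))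
    {P P' : Subtype p} (h : Relation.EqvGen r P P') :
    ∃ φ : V ≃+ V,
      (Finset.univ.val.map P.1.1).map φ = Finset.univ.val.map P'.1.1 ∧
      (Finset.univ.val.map P.1.2).map φ = Finset.univ.val.map P'.1.2 := by
  induction h with
  | rel P P' h =>
    obtain ⟨σ, τ, φ, h1, h2⟩ := hr P P' h
    exact ⟨φ, map_entries_eq φ σ h1, map_entries_eq φ τ h2⟩
  | refl P => exact ⟨AddEquiv.refl V, by simp, by simp⟩
  | symm P P' _ ih =>
    obtain ⟨φ, h1, h2⟩ := ih
    exact ⟨φ.symm, by rw [← h1]; simp, by rw [← h2]; simp⟩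
  | trans P Q R _ _ ih1 ih2 =>
    obtain ⟨φ, h1, h2⟩ := ih1
    obtain ⟨ψ, h3, h4⟩ := ih2
    exact ⟨φ.trans ψ, by rw [← h3, ← h1, Multiset.map_map ψ φ]; rfl,
      by rw [← h4, ← h2, Multiset.map_map ψ φ]; rfl⟩

/-- Let `k ≥ 3` and `l` be integers with `2^{l-k} + 2 ≥ 2^k - k - 1`, and
set `G = (ℤ/2ℤ)^k`, `r₁ = k(k+1)`, `r₂ = 2^{l-k+1} + 4`. Consider the set of pairs
`(T₁, T₂)` of an `r₁`-tuple and an `r₂`-tuple of elements of `G`, each a spherical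
system of generators of `G` (all entries nonzero, entries generating `G`, entries
summing to `0`), such that no nonzero element of `G` occurs both as an entry of `T₁`
and as an entry of `T₂`. Then the number of orbits of this set under the action of
`𝔖_{r₁} × 𝔖_{r₂} × Aut(G)` (permuting the entries of each tuple and applying the
automorphism simultaneously to all entries) is at least `C(2^{l-k}+1, 2^k-k-2)`. -/
theorem stmt10 (k l : ℕ) (hk : 3 ≤ k) (hl : 2 ^ k - k - 1 ≤ 2 ^ (l - k) + 2) :
    Nat.choose (2 ^ (l - k) + 1) (2 ^ k - k - 2) ≤
      Nat.card (Quotient (Relation.EqvGen.setoid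
        (fun (P P' : {P : (Fin (k * (k + 1)) → (Fin k → ZMod 2)) ×
              (Fin (2 ^ (l - k + 1) + 4) → (Fin k → ZMod 2)) //
            ((∀ i, P.1 i ≠ 0) ∧ AddSubgroup.closure (Set.range P.1) = ⊤ ∧ ∑ i, P.1 i = 0) ∧
            ((∀ j, P.2 j ≠ 0) ∧ AddSubgroup.closure (Set.range P.2) = ⊤ ∧ ∑ j, P.2 j = 0) ∧
            (∀ v : Fin k → ZMod 2, v ≠ 0 →
              ¬(v ∈ Set.range P.1 ∧ v ∈ Set.range P.2))}) =>
          ∃ (σ : Equiv.Perm (Fin (k * (k + 1))))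
            (τ : Equiv.Perm (Fin (2 ^ (l - k + 1) + 4)))
            (φ : (Fin k → ZMod 2) ≃+ (Fin k → ZMod 2)),
            (∀ x, φ (P.1.1 (σ x)) = P'.1.1 x) ∧ (∀ x, φ (P.1.2 (τ x)) = P'.1.2 x)))) := by
  classical
  set n := 2 ^ (l - k) + 1 + 1 - (2 ^ k - k - 1) with hn
  rw [choose_eq_card_sym hk hl]
  have hr : ∀ s : Sym (NonBasis k) n, (nonBasisMultiset s).card = 2 ^ (l - k + 1) + 4 := by
    intro s
    rw [card_nonBasisMultiset, pow_succ]
    omega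
  obtain ⟨f, hf⟩ := exists_tuple_of_card _ _ (card_basisMultiset k)
  choose g hg using fun s : Sym (NonBasis k) n => exists_tuple_of_card _ _ (hr s)
  have hfmem : ∀ v, v ∈ Set.range f ↔ ∃ i, v = Pi.single i 1 := by
    intro v
    rw [← mem_basisMultiset, ← hf]
    simp only [Multiset.mem_map, Finset.mem_val, Finset.mem_univ, true_and, Set.mem_range]
  have hgmem : ∀ s v, v ∈ Set.range (g s) ↔ v ≠ 0 ∧ ∀ i, v ≠ Pi.single i 1 := by
    intro s v
    rw [← mem_nonBasisMultiset s, ← hg s]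
    simp only [Multiset.mem_map, Finset.mem_val, Finset.mem_univ, true_and, Set.mem_range]
  have hfrange : Set.range f = Set.range fun i : Fin k => (Pi.single i 1 : Fin k → ZMod 2) := by
    ext v
    rw [hfmem]
    simp [eq_comm]
  refine Nat.card_le_card_of_injective (fun s => Quotient.mk _ ⟨(f, g s), ⟨?_, ?_, ?_⟩,
    ⟨?_, ?_, ?_⟩, ?_⟩) ?_
  · intro i
    obtain ⟨j, hj⟩ := (hfmem _).1 ⟨i, rfl⟩
    simp [hj]
  · rw [hfrange, closure_range_single_one]
  · rw [← sum_basisMultiset k, ← hf]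
    rfl
  · exact fun j => ((hgmem s _).1 ⟨j, rfl⟩).1
  · rw [← closure_nonBasis hk]
    exact congrArg _ (Set.ext (hgmem s))
  · rw [← sum_nonBasisMultiset s, ← hg s]
    rfl
  · rintro v - ⟨h1, h2⟩
    obtain ⟨i, hi⟩ := (hfmem v).1 h1
    exact ((hgmem s v).1 h2).2 i hi
  · intro s t hst
    obtain ⟨φ, h1, h2⟩ := exists_addEquiv_of_eqvGen (fun P P' h => h) (Quotient.exact hst)
    simp only [hf, hg] at h1 h2
    rw [eq_refl_of_map_basisMultiset φ h1] at h2
    exact nonBasisMultiset_injective k n (by simpa using h2)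
end

section
/- Let $\alpha$ be a real number with $0 < \alpha < \tfrac{1}{2}$. Then there exist a positive rational number $\nu$ and $K$ such that for all integers $k \geq K$ with $\nu k \in \mathbb{Z}$, setting $e_k := 2^{(\nu+2)k-1}(k^2+k-4)$, one has $\binom{2^{(\nu+1)k}+1}{2^k-k-2} > e_k^{\,e_k^{\alpha}}$. -/
/-- The central binomial coefficient `C(2r, r)` is at least `2 ^ r`. -/
theorem two_pow_le_centralBinom (r : ℕ) : 2 ^ r ≤ r.centralBinom := by
  induction r with
  | zero => simp
  | succ r ih =>
    have h := Nat.succ_mul_centralBinom_succ r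
    refine le_of_mul_le_mul_left (a := r + 1) ?_ r.succ_pos
    rw [h, pow_succ]
    nlinarith [Nat.zero_le (r * r.centralBinom), Nat.mul_le_mul_left r ih]

theorem two_pow_le_choose {n r : ℕ} (h : 2 * r ≤ n) : 2 ^ r ≤ n.choose r :=
  (two_pow_le_centralBinom r).trans (Nat.choose_le_choose r h)

theorem add_two_le_two_pow_pred {k : ℕ} (hk : 4 ≤ k) : k + 2 ≤ 2 ^ (k - 1) := by
  induction k, hk using Nat.le_induction with
  | base => norm_num
  | succ k hk ih =>
    obtain ⟨j, rfl⟩ : ∃ j, k = j + 1 := ⟨k - 1, by omega⟩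
    simp only [Nat.add_sub_cancel] at ih ⊢
    rw [pow_succ]
    omega

/-- An exponential of base `2 ^ β` with `β < 1`, times `k ^ 2`, is eventually smaller than any
fixed multiple of `2 ^ k`. -/
theorem eventually_sq_mul_two_rpow_lt {β c : ℝ} (hβ : β < 1) (hc : 0 < c) :
    ∀ᶠ k : ℕ in Filter.atTop, (k : ℝ) ^ 2 * 2 ^ (β * k) < c * 2 ^ k := by
  have hb : |(2 : ℝ) ^ (β - 1)| < 1 := by
    rw [abs_of_pos (by positivity)]
    exact Real.rpow_lt_one_of_one_lt_of_neg (by norm_num) (by linarith)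
  filter_upwards [(tendsto_pow_const_mul_const_pow_of_abs_lt_one 2 hb).eventually_lt_const hc]
    with k hk
  have h : ((2 : ℝ) ^ (β - 1)) ^ k * 2 ^ k = 2 ^ (β * k) := by
    rw [← Real.rpow_natCast, ← Real.rpow_natCast, ← Real.rpow_mul (by norm_num),
      ← Real.rpow_add (by norm_num)]
    ring_nf
  calc (k : ℝ) ^ 2 * 2 ^ (β * k) = (k : ℝ) ^ 2 * ((2 : ℝ) ^ (β - 1)) ^ k * 2 ^ k := by
        rw [← h, mul_assoc]
    _ < c * 2 ^ k := by gcongr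

/-- Let `0 < α < 1/2`. Then there exist a positive rational `ν` and `K`
such that for all integers `k ≥ K` with `νk ∈ ℤ` (say `νk = m`), setting
`e_k := 2^{(ν+2)k - 1}(k² + k - 4)` (note `(ν+2)k - 1 = m + 2k - 1` and
`(ν+1)k = m + k`), one has `C(2^{(ν+1)k} + 1, 2^k - k - 2) > e_k^{e_k^α}`. -/
theorem stmt15 (α : ℝ) (h0 : 0 < α) (h1 : α < 1 / 2) :
    ∃ ν : ℚ, 0 < ν ∧ ∃ K : ℕ, ∀ k : ℕ, K ≤ k → ∀ m : ℕ, ν * (k : ℚ) = (m : ℚ) →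
      ∀ ek : ℝ, ek = 2 ^ (m + 2 * k - 1) * ((k : ℝ) ^ 2 + (k : ℝ) - 4) →
        ek ^ (ek ^ α) < (Nat.choose (2 ^ (m + k) + 1) (2 ^ k - k - 2) : ℝ) := by
  have hgap : (0 : ℝ) < min 1 (1 / α - 2) := by
    refine lt_min one_pos ?_
    rw [sub_pos, lt_div_iff₀ h0]
    linarith
  obtain ⟨ν, hν0, hν⟩ := exists_rat_btwn hgap
  obtain ⟨hν1, hν2⟩ := lt_min_iff.1 hν
  have hβ : α * (ν + 2) < 1 := by
    have h : (ν : ℝ) + 2 < 1 / α := by linarith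
    rw [lt_div_iff₀ h0] at h
    linarith
  obtain ⟨K, hK⟩ := Filter.eventually_atTop.1
    (eventually_sq_mul_two_rpow_lt hβ (c := 1 / 10) (by norm_num))
  refine ⟨ν, by exact_mod_cast hν0, max K 4, fun k hk m hm ek hek => ?_⟩
  have hk4 : 4 ≤ k := (le_max_right _ _).trans hk
  have hkK := hK k ((le_max_left _ _).trans hk)
  have hk4' : (4 : ℝ) ≤ k := by exact_mod_cast hk4
  have hmR : (ν : ℝ) * k = m := by exact_mod_cast hm
  have hm1 : 1 ≤ m := by
    have : (0 : ℝ) < m := hmR ▸ mul_pos hν0 (by linarith)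
    exact_mod_cast this
  have hmk : m ≤ k := by
    have : (m : ℝ) ≤ k := by rw [← hmR]; nlinarith
    exact_mod_cast this
  have hek1 : 1 ≤ ek := by
    rw [hek]
    exact one_le_mul_of_one_le_of_one_le (one_le_pow₀ (by norm_num)) (by nlinarith)
  have hek_le : ek ≤ 2 ^ (m + 2 * k) * (k : ℝ) ^ 2 := by
    obtain ⟨j, hj⟩ : ∃ j, m + 2 * k = j + 1 := ⟨m + 2 * k - 1, by omega⟩
    rw [hek, hj, Nat.add_sub_cancel, pow_succ 2 j, mul_assoc]
    gcongr
    nlinarith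
  have hek_le_pow : ek ≤ 2 ^ (5 * k) := by
    have hk2 : (k : ℝ) ≤ 2 ^ k := by exact_mod_cast k.lt_two_pow_self.le
    calc ek ≤ 2 ^ (m + 2 * k) * (k : ℝ) ^ 2 := hek_le
      _ ≤ 2 ^ (k + 2 * k) * (2 ^ k) ^ 2 := by gcongr; norm_num
      _ = 2 ^ (5 * k) := by ring
  have hekα : ek ^ α ≤ 2 ^ (α * (ν + 2) * k) * k := by
    calc ek ^ α ≤ (2 ^ (m + 2 * k) * (k : ℝ) ^ 2) ^ α := by gcongr
      _ = 2 ^ (α * (ν + 2) * k) * (k : ℝ) ^ (2 * α) := by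
        rw [Real.mul_rpow (by positivity) (by positivity), ← Real.rpow_natCast,
          ← Real.rpow_natCast, ← Real.rpow_mul (by norm_num), ← Real.rpow_mul (by positivity)]
        push_cast
        rw [← hmR]
        ring_nf
      _ ≤ 2 ^ (α * (ν + 2) * k) * (k : ℝ) ^ (1 : ℝ) := by
        gcongr
        · linarith
        · linarith
      _ = 2 ^ (α * (ν + 2) * k) * k := by rw [Real.rpow_one]
  have hpow : 2 ^ k = 2 * 2 ^ (k - 1) := by
    rw [← pow_succ', Nat.sub_add_cancel (by omega)]
  have hr : (2 : ℝ) ^ k / 2 ≤ (2 ^ k - k - 2 : ℕ) := by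
    have h := add_two_le_two_pow_pred hk4
    have h' : 2 ^ k ≤ (2 ^ k - k - 2) * 2 := by omega
    rw [div_le_iff₀ two_pos]
    exact_mod_cast h'
  have hexp : 5 * k * ek ^ α < (2 ^ k - k - 2 : ℕ) := by
    calc 5 * k * ek ^ α ≤ 5 * k * (2 ^ (α * (ν + 2) * k) * k) := by gcongr
      _ = 5 * ((k : ℝ) ^ 2 * 2 ^ (α * (ν + 2) * k)) := by ring
      _ < 2 ^ k / 2 := by linarith
      _ ≤ _ := hr
  have hchoose : 2 ^ (2 ^ k - k - 2) ≤ Nat.choose (2 ^ (m + k) + 1) (2 ^ k - k - 2) := by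
    apply two_pow_le_choose
    have h : 2 ^ (1 + k) ≤ 2 ^ (m + k) := Nat.pow_le_pow_right two_pos (by omega)
    rw [pow_add] at h
    omega
  calc ek ^ (ek ^ α) ≤ (2 ^ (5 * k)) ^ (ek ^ α) := by gcongr
    _ = (2 : ℝ) ^ (5 * k * ek ^ α) := by
      rw [← Real.rpow_natCast, ← Real.rpow_mul (by norm_num)]
      push_cast
      rfl
    _ < (2 : ℝ) ^ ((2 ^ k - k - 2 : ℕ) : ℝ) := Real.rpow_lt_rpow_of_exponent_lt (by norm_num) hexp
    _ = (2 ^ (2 ^ k - k - 2) : ℕ) := by rw [Real.rpow_natCast]; push_cast; rfl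
    _ ≤ _ := by exact_mod_cast hchoose
end
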